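/- Let a ≥ 0 and let g : [a,∞) → (0,∞) be continuous with G(t) := ∫ₐᵗ g(s) ds → +∞ as t → ∞. Let u : [a,∞) → ℝ be continuous, and assume that s ↦ (g(s)/G(s))·u(s) is Lebesgue-integrable on (a,t] for every t > a and that ∫_{(a,t]} (g(s)/G(s))·u(s) ds converges to a finite limit as t → ∞. Then (∫ₐᵗ g(s) u(s) ds) / G(t) → 0 as t → ∞. -/

import Mathlib

open MeasureTheory Set Filter

/-- The primitive of a function that is continuous on `Ioi a` and integrable up to `x > a` is
differentiable at `x`. -/
theorem hasDerivAt_integral_of_continuousOn_Ioi {f : ℝ → ℝ} {a x : ℝ}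
    (hf : ContinuousOn f (Ioi a)) (hint : IntervalIntegrable f volume a x) (hx : a < x) :
    HasDerivAt (fun t => ∫ s in a..t, f s) (f x) x :=
  intervalIntegral.integral_hasDerivAt_right hint
    (hf.stronglyMeasurableAtFilter isOpen_Ioi x hx) (hf.continuousAt (Ioi_mem_nhds hx))

/-- If `H` is bounded by `ε` on `[T, t]` and `G` is nonnegative and increasing there, then
integrating `G * H'` by parts gives a bound by `2 * ε * G t`. -/
theorem abs_integral_mul_deriv_le {G g H k : ℝ → ℝ} {T t ε : ℝ} (hTt : T ≤ t)
    (hG : ∀ x ∈ Icc T t, HasDerivAt G (g x) x) (hH : ∀ x ∈ Icc T t, HasDerivAt H (k x) x)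
    (hg : IntervalIntegrable g volume T t) (hk : IntervalIntegrable k volume T t)
    (hg_nonneg : ∀ x ∈ Icc T t, 0 ≤ g x) (hGT : 0 ≤ G T)
    (hHε : ∀ x ∈ Icc T t, |H x| ≤ ε) :
    |∫ s in T..t, G s * k s| ≤ 2 * ε * G t := by
  have hu : uIcc T t = Icc T t := uIcc_of_le hTt
  have hftc : ∫ s in T..t, g s = G t - G T :=
    intervalIntegral.integral_eq_sub_of_hasDerivAt (by rwa [hu]) hg
  have hmono : 0 ≤ ∫ s in T..t, g s := intervalIntegral.integral_nonneg hTt hg_nonneg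
  have hGt : 0 ≤ G t := by linarith
  rw [intervalIntegral.integral_mul_deriv_eq_deriv_mul (by rwa [hu]) (by rwa [hu]) hg hk]
  have hbound : |∫ s in T..t, g s * H s| ≤ ε * (G t - G T) := by
    rw [← hftc, ← intervalIntegral.integral_const_mul, ← Real.norm_eq_abs]
    refine intervalIntegral.norm_integral_le_of_norm_le hTt
      (Eventually.of_forall fun s hs => ?_) (hg.const_mul ε)
    have hs' := Ioc_subset_Icc_self hs
    rw [Real.norm_eq_abs, abs_mul, abs_of_nonneg (hg_nonneg s hs'), mul_comm]
    exact mul_le_mul_of_nonneg_right (hHε s hs') (hg_nonneg s hs')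
  have hboundary_right : |G t * H t| ≤ ε * G t := by
    rw [abs_mul, abs_of_nonneg hGt, mul_comm]
    exact mul_le_mul_of_nonneg_right (hHε t (right_mem_Icc.2 hTt)) hGt
  have hboundary_left : |G T * H T| ≤ ε * G T := by
    rw [abs_mul, abs_of_nonneg hGT, mul_comm]
    exact mul_le_mul_of_nonneg_right (hHε T (left_mem_Icc.2 hTt)) hGT
  rw [abs_le] at *
  constructor <;> linarith

/-- Continuous-time deterministic Kronecker lemma. -/
theorem kronecker_continuous_time
    (a : ℝ) (ha : 0 ≤ a) (g u : ℝ → ℝ)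
    (hg_cont : ContinuousOn g (Ici a)) (hg_pos : ∀ t ∈ Ici a, 0 < g t)
    (hG_top : Tendsto (fun t => ∫ s in a..t, g s) atTop atTop)
    (hu_cont : ContinuousOn u (Ici a))
    (h_int : ∀ t > a,
      IntegrableOn (fun s => g s / (∫ x in a..s, g x) * u s) (Ioc a t))
    (h_conv : ∃ I : ℝ,
      Tendsto (fun t => ∫ s in Ioc a t, g s / (∫ x in a..s, g x) * u s)
        atTop (nhds I)) :
    Tendsto (fun t => (∫ s in a..t, g s * u s) / ∫ s in a..t, g s)
      atTop (nhds 0) := by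
  obtain ⟨I, hI⟩ := h_conv
  have intervalIntegrable_of_cont {f : ℝ → ℝ} (hf : ContinuousOn f (Ici a)) {x y : ℝ}
      (hx : a ≤ x) (hy : a ≤ y) : IntervalIntegrable f volume x y :=
    (hf.mono fun z hz => (le_min hx hy).trans hz.1).intervalIntegrable
  set G : ℝ → ℝ := fun t => ∫ s in a..t, g s
  set k : ℝ → ℝ := fun s => g s / G s * u s with hk_def
  set H : ℝ → ℝ := fun t => (∫ s in a..t, k s) - I with hH_def
  have hG_pos {x : ℝ} (hx : a < x) : 0 < G x :=
    intervalIntegral.intervalIntegral_pos_of_pos_on (intervalIntegrable_of_cont hg_cont le_rfl hx.le)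
      (fun s hs => hg_pos s hs.1.le) hx
  have hG_deriv {x : ℝ} (hx : a < x) : HasDerivAt G (g x) x :=
    hasDerivAt_integral_of_continuousOn_Ioi (hg_cont.mono Ioi_subset_Ici_self)
      (intervalIntegrable_of_cont hg_cont le_rfl hx.le) hx
  have hk_int {x : ℝ} (hx : a < x) : IntervalIntegrable k volume a x :=
    (intervalIntegrable_iff_integrableOn_Ioc_of_le hx.le).2 (h_int x hx)
  have hk_cont : ContinuousOn k (Ioi a) :=
    ((hg_cont.mono Ioi_subset_Ici_self).div
      (fun x hx => (hG_deriv hx).continuousAt.continuousWithinAt)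
      fun x hx => (hG_pos hx).ne').mul (hu_cont.mono Ioi_subset_Ici_self)
  have hH_deriv {x : ℝ} (hx : a < x) : HasDerivAt H (k x) x :=
    (hasDerivAt_integral_of_continuousOn_Ioi hk_cont (hk_int hx) hx).sub_const I
  have hH_lim : Tendsto H atTop (nhds 0) := by
    rw [← sub_self I]
    refine (hI.sub_const I).congr' ?_
    filter_upwards [eventually_ge_atTop a] with t ht
    simp only [hH_def, intervalIntegral.integral_of_le ht]
  rw [Metric.tendsto_atTop'] at hH_lim
  rw [Metric.tendsto_nhds]
  intro ε hε
  obtain ⟨N, hN⟩ := hH_lim (ε / 4) (by positivity)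
  obtain ⟨T, hTN, haT⟩ : ∃ T, N < T ∧ a < T :=
    ⟨max N a + 1, by linarith [le_max_left N a], by linarith [le_max_right N a]⟩
  filter_upwards [eventually_ge_atTop T,
    hG_top.eventually_gt_atTop (|∫ s in a..T, g s * u s| / (ε / 2))] with t hTt hGt
  have hat : a < t := haT.trans_le hTt
  have hgu : ContinuousOn (fun s => g s * u s) (Ici a) := hg_cont.mul hu_cont
  have htail : |∫ s in T..t, g s * u s| ≤ 2 * (ε / 4) * G t := by
    have hcongr : ∫ s in T..t, g s * u s = ∫ s in T..t, G s * k s := by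
      refine intervalIntegral.integral_congr fun s hs => ?_
      rw [uIcc_of_le hTt] at hs
      have := (hG_pos (haT.trans_le hs.1)).ne'
      simp only [hk_def]
      field_simp
    rw [hcongr]
    refine abs_integral_mul_deriv_le hTt (fun x hx => hG_deriv (haT.trans_le hx.1))
      (fun x hx => hH_deriv (haT.trans_le hx.1)) (intervalIntegrable_of_cont hg_cont haT.le hat.le)
      ((hk_int haT).symm.trans (hk_int hat)) (fun x hx => (hg_pos x (haT.le.trans hx.1)).le)
      (hG_pos haT).le fun x hx => ?_
    simpa using (hN x (hTN.trans_le hx.1)).le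
  rw [div_lt_iff₀ (by positivity)] at hGt
  rw [dist_zero_right, Real.norm_eq_abs, abs_div, abs_of_pos (hG_pos hat), div_lt_iff₀ (hG_pos hat),
    ← intervalIntegral.integral_add_adjacent_intervals
      (intervalIntegrable_of_cont hgu le_rfl haT.le) (intervalIntegrable_of_cont hgu haT.le hat.le)]
  refine (abs_add_le _ _).trans_lt ?_
  linarith
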